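/- Let A be a homological category and F : A → F the reflector onto a full replete (normal epi)-reflective subcategory F of A. The following conditions are equivalent: (1) F is protoadditive; (2) F sends protosplit monomorphisms to normal monomorphisms; (3) F sends protosplit monomorphisms to monomorphisms. -/

import Mathlib

open CategoryTheory CategoryTheory.Limits

universe v u v₂ u₂

namespace ProtoPaper

variable {C : Type u} [Category.{v} C]

section ZeroDefs

variable [HasZeroMorphisms C]

/-- `k` is a kernel of `f`. -/
def IsKernelOf {K A B : C} (k : K ⟶ A) (f : A ⟶ B) : Prop :=
  ∃ w : k ≫ f = 0, Nonempty (IsLimit (KernelFork.ofι k w))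

/-- `f` is a cokernel of `k`. -/
def IsCokernelOf {K A B : C} (f : A ⟶ B) (k : K ⟶ A) : Prop :=
  ∃ w : k ≫ f = 0, Nonempty (IsColimit (CokernelCofork.ofπ f w))

/-- A normal monomorphism: a kernel of some morphism. -/
def IsNormalMonoArrow {K A : C} (k : K ⟶ A) : Prop :=
  ∃ (B : C) (f : A ⟶ B), IsKernelOf k f

/-- A normal epimorphism: a cokernel of some morphism. -/
def IsNormalEpiArrow {A B : C} (f : A ⟶ B) : Prop :=
  ∃ (K : C) (k : K ⟶ A), IsCokernelOf f k

/-- A split short exact sequence `0 → K → A ⇄ B → 0`. -/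
structure IsSplitShortExact {K A B : C} (k : K ⟶ A) (f : A ⟶ B) (s : B ⟶ A) : Prop where
  isKernel : IsKernelOf k f
  split : s ≫ f = 𝟙 B

/-- A short exact sequence `0 → K → A → B → 0`. -/
structure IsShortExact {K A B : C} (k : K ⟶ A) (f : A ⟶ B) : Prop where
  isKernel : IsKernelOf k f
  isCokernel : IsCokernelOf f k

/-- A protosplit monomorphism: a kernel of a split epimorphism. -/
def IsProtosplitMono {K A : C} (k : K ⟶ A) : Prop :=
  ∃ (B : C) (f : A ⟶ B) (s : B ⟶ A), IsSplitShortExact k f s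

end ZeroDefs

/-- A pointed category is protomodular when the split short five lemma holds. -/
def IsProtomodular (C : Type u) [Category.{v} C] [HasZeroMorphisms C] : Prop :=
  ∀ ⦃K A B K' A' B' : C⦄ (k : K ⟶ A) (f : A ⟶ B) (s : B ⟶ A)
    (k' : K' ⟶ A') (f' : A' ⟶ B') (s' : B' ⟶ A')
    (κ : K ⟶ K') (α : A ⟶ A') (β : B ⟶ B'),
    IsSplitShortExact k f s → IsSplitShortExact k' f' s' →
    k ≫ α = κ ≫ k' → f ≫ β = α ≫ f' → s ≫ α = β ≫ s' →
    IsIso κ → IsIso β → IsIso α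

section Functors

variable {D : Type u₂} [Category.{v₂} D]

/-- A functor is protoadditive if it preserves split short exact sequences. -/
def IsProtoadditive [HasZeroMorphisms C] [HasZeroMorphisms D] (F : C ⥤ D) : Prop :=
  ∀ ⦃K A B : C⦄ (k : K ⟶ A) (f : A ⟶ B) (s : B ⟶ A),
    IsSplitShortExact k f s → IsSplitShortExact (F.map k) (F.map f) (F.map s)

/-- A functor preserves zero objects. -/
def PreservesZeroObjects (F : C ⥤ D) : Prop :=
  ∀ X : C, IsZero X → IsZero (F.obj X)

/-- A functor preserves pullbacks along split epimorphisms. -/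
def PreservesPullbacksAlongSplitEpis (F : C ⥤ D) : Prop :=
  ∀ ⦃P X Y Z : C⦄ (fst : P ⟶ X) (snd : P ⟶ Y) (f : X ⟶ Z) (g : Y ⟶ Z),
    IsSplitEpi f → IsPullback fst snd f g →
    IsPullback (F.map fst) (F.map snd) (F.map f) (F.map g)

end Functors

/-- A homological category: pointed, protomodular and regular (finitely complete with
pullback-stable (regular epi, mono) factorisations). -/
structure IsHomological (C : Type u) [Category.{v} C] [HasZeroObject C]
    [HasZeroMorphisms C] : Prop where
  protomodular : IsProtomodular C
  hasFiniteLimits : HasFiniteLimits C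
  regEpiMonoFac : ∀ ⦃X Y : C⦄ (f : X ⟶ Y),
    ∃ (I : C) (e : X ⟶ I) (m : I ⟶ Y), Nonempty (RegularEpi e) ∧ Mono m ∧ e ≫ m = f
  regEpiStable : ∀ ⦃P X Y Z : C⦄ (fst : P ⟶ X) (snd : P ⟶ Y) (f : X ⟶ Z) (g : Y ⟶ Z),
    IsPullback fst snd f g → Nonempty (RegularEpi f) → Nonempty (RegularEpi snd)

/-- An internal equivalence relation, given by a jointly monic pair which is internally
reflexive, symmetric and transitive. -/
structure IsInternalEquivRel {R X : C} (p₁ p₂ : R ⟶ X) : Prop where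
  jointlyMono : ∀ ⦃Z : C⦄ (a b : Z ⟶ R), a ≫ p₁ = b ≫ p₁ → a ≫ p₂ = b ≫ p₂ → a = b
  refl : ∃ d : X ⟶ R, d ≫ p₁ = 𝟙 X ∧ d ≫ p₂ = 𝟙 X
  symm : ∃ σ : R ⟶ R, σ ≫ p₁ = p₂ ∧ σ ≫ p₂ = p₁
  trans : ∀ ⦃P : C⦄ (q₁ q₂ : P ⟶ R), IsPullback q₁ q₂ p₂ p₁ →
    ∃ t : P ⟶ R, t ≫ p₁ = q₁ ≫ p₁ ∧ t ≫ p₂ = q₂ ≫ p₂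

/-- A semi-abelian category: homological, with binary coproducts, and exact
(every internal equivalence relation is a kernel pair). -/
structure IsSemiAbelian (C : Type u) [Category.{v} C] [HasZeroObject C]
    [HasZeroMorphisms C] : Prop where
  homological : IsHomological C
  hasBinaryCoproducts : HasBinaryCoproducts C
  equivRelEffective : ∀ ⦃R X : C⦄ (p₁ p₂ : R ⟶ X), IsInternalEquivRel p₁ p₂ →
    ∃ (Y : C) (f : X ⟶ Y), IsPullback p₁ p₂ f f

/-- A full subcategory (given by a predicate on objects) is replete if it is closed
under isomorphisms. -/
def Replete (P : C → Prop) : Prop := ∀ ⦃X Y : C⦄, P X → (X ≅ Y) → P Y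

/-- A reflection of `C` onto the full subcategory of objects satisfying `P`:
a reflector `F`, a unit `η`, landing in `P`, with the usual universal property. -/
structure Reflection (C : Type u) [Category.{v} C] (P : C → Prop) where
  F : C ⥤ C
  η : 𝟭 C ⟶ F
  mem : ∀ X : C, P (F.obj X)
  univ : ∀ ⦃X B : C⦄, P B → ∀ f : X ⟶ B, ∃! g : F.obj X ⟶ B, η.app X ≫ g = f

variable {P : C → Prop}

/-- A (normal epi)-reflection: all units are normal epimorphisms. -/
def NormalEpiUnits [HasZeroMorphisms C] (R : Reflection C P) : Prop :=
  ∀ X : C, IsNormalEpiArrow (R.η.app X)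

/-- `f` is a trivial extension with respect to the reflection `R`. -/
def IsTrivialExt (R : Reflection C P) {A B : C} (f : A ⟶ B) : Prop :=
  IsPullback (R.η.app A) f (R.F.map f) (R.η.app B)

/-- `p` is an effective descent morphism: the pullback functor between the slice
categories is monadic. -/
def IsEffectiveDescent [HasPullbacks C] {E B : C} (p : E ⟶ B) : Prop :=
  Nonempty (MonadicRightAdjoint (Over.pullback p))

/-- A central extension with respect to the (absolute) Galois structure of a reflection:
some pullback along an effective descent morphism is a trivial extension. -/
def IsCentralExt [HasPullbacks C] (R : Reflection C P) {A B : C} (f : A ⟶ B) : Prop :=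
  ∃ (E : C) (p : E ⟶ B), IsEffectiveDescent p ∧
    ∃ (Pb : C) (p1 : Pb ⟶ E) (p2 : Pb ⟶ A), IsPullback p1 p2 p f ∧ IsTrivialExt R p1

/-- A normal extension with respect to the (absolute) Galois structure of a reflection. -/
def IsNormalExt [HasPullbacks C] (R : Reflection C P) {A B : C} (f : A ⟶ B) : Prop :=
  IsEffectiveDescent f ∧
    ∃ (Pb : C) (p1 p2 : Pb ⟶ A), IsPullback p1 p2 f f ∧ IsTrivialExt R p1

/-- A central extension with respect to the Galois structure of a reflection relative to
the class of normal epimorphisms. -/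
def IsCentralExtN [HasZeroMorphisms C] (R : Reflection C P) {A B : C} (f : A ⟶ B) : Prop :=
  IsNormalEpiArrow f ∧ ∃ (E : C) (p : E ⟶ B), IsNormalEpiArrow p ∧
    ∃ (Pb : C) (p1 : Pb ⟶ E) (p2 : Pb ⟶ A), IsPullback p1 p2 p f ∧ IsTrivialExt R p1

/-- A normal extension with respect to the Galois structure of a reflection relative to
the class of normal epimorphisms. -/
def IsNormalExtN [HasZeroMorphisms C] (R : Reflection C P) {A B : C} (f : A ⟶ B) : Prop :=
  IsNormalEpiArrow f ∧
    ∃ (Pb : C) (p1 p2 : Pb ⟶ A), IsPullback p1 p2 f f ∧ IsTrivialExt R p1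

/-- The reflector is semi-left-exact: it preserves pullbacks of units along morphisms
with domain in the subcategory. -/
def SemiLeftExact (R : Reflection C P) : Prop :=
  ∀ ⦃A X Pb : C⦄ (x : X ⟶ R.F.obj A) (p1 : Pb ⟶ A) (p2 : Pb ⟶ X), P X →
    IsPullback p1 p2 (R.η.app A) x →
    IsPullback (R.F.map p1) (R.F.map p2) (R.F.map (R.η.app A)) (R.F.map x)

/-- The reflector has stable units: it preserves pullbacks of units along arbitrary
morphisms. -/
def StableUnits (R : Reflection C P) : Prop :=
  ∀ ⦃A X Pb : C⦄ (x : X ⟶ R.F.obj A) (p1 : Pb ⟶ A) (p2 : Pb ⟶ X),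
    IsPullback p1 p2 (R.η.app A) x →
    IsPullback (R.F.map p1) (R.F.map p2) (R.F.map (R.η.app A)) (R.F.map x)

/-- The reflection is admissible with respect to the class of normal epimorphisms:
the reflector preserves pullbacks of units along normal epimorphisms with domain in
the subcategory. -/
def AdmissibleN [HasZeroMorphisms C] (R : Reflection C P) : Prop :=
  ∀ ⦃A X Pb : C⦄ (x : X ⟶ R.F.obj A) (p1 : Pb ⟶ A) (p2 : Pb ⟶ X), P X →
    IsNormalEpiArrow x →
    IsPullback p1 p2 (R.η.app A) x →
    IsPullback (R.F.map p1) (R.F.map p2) (R.F.map (R.η.app A)) (R.F.map x)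

/-- The radical associated to a (normal epi)-reflection is idempotent. -/
def IdempotentRadical [HasZeroMorphisms C] (R : Reflection C P) : Prop :=
  ∀ ⦃A TA : C⦄ (t : TA ⟶ A), IsKernelOf t (R.η.app A) →
    ∀ ⦃T2 : C⦄ (t2 : T2 ⟶ TA), IsKernelOf t2 (R.η.app TA) → IsIso t2

/-- Condition (N) for a (normal epi)-reflection: for any morphism `f` with kernel
`k : K ⟶ A`, and any kernel `t : TK ⟶ K` of the unit at `K`, the composite `t ≫ k`
is a normal monomorphism. -/
def ConditionN [HasZeroMorphisms C] (R : Reflection C P) : Prop :=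
  ∀ ⦃A B : C⦄ (f : A ⟶ B) ⦃K : C⦄ (k : K ⟶ A), IsKernelOf k f →
    ∀ ⦃TK : C⦄ (t : TK ⟶ K), IsKernelOf t (R.η.app K) → IsNormalMonoArrow (t ≫ k)

/-- A torsion theory on a pointed category, given by a pair of full replete
subcategories. -/
structure TorsionTheory (C : Type u) [Category.{v} C] [HasZeroMorphisms C]
    (T F : C → Prop) : Prop where
  repleteT : Replete T
  repleteF : Replete F
  hom_zero : ∀ ⦃X Y : C⦄ (f : X ⟶ Y), T X → F Y → f = 0
  exists_ses : ∀ A : C, ∃ (TA FA : C) (t : TA ⟶ A) (q : A ⟶ FA),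
    T TA ∧ F FA ∧ IsShortExact t q

/-- Condition (N) for a torsion theory, formulated without reference to a chosen
reflector: for any morphism `f` with kernel `k : K ⟶ A` and any short exact sequence
`0 → TK → K → FK → 0` with `TK` torsion and `FK` torsion-free, the composite
`TK → A` is a normal monomorphism. -/
def TTConditionN [HasZeroMorphisms C] (T F : C → Prop) : Prop :=
  ∀ ⦃A B K TK FK : C⦄ (f : A ⟶ B) (k : K ⟶ A) (t : TK ⟶ K) (q : K ⟶ FK),
    IsKernelOf k f → T TK → F FK → IsShortExact t q → IsNormalMonoArrow (t ≫ k)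

/-- Condition (P) for a torsion theory: the torsion-free reflector is protoadditive
(formulated for every (normal epi)-reflection onto the torsion-free part). -/
def TTConditionP [HasZeroMorphisms C] (T F : C → Prop) : Prop :=
  ∀ R : Reflection C F, NormalEpiUnits R → IsProtoadditive R.F

/-- Orthogonality `e ↓ m` of two morphisms. -/
def Orthogonal {A B X Y : C} (e : A ⟶ B) (m : X ⟶ Y) : Prop :=
  ∀ (a : A ⟶ X) (b : B ⟶ Y), e ≫ b = a ≫ m →
    ∃! d : B ⟶ X, e ≫ d = a ∧ d ≫ m = b

/-- The class of morphisms orthogonal on the right to all members of `E`. -/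
def dnOrth (E : MorphismProperty C) : MorphismProperty C :=
  fun _ _ m => ∀ ⦃A B : C⦄ (e : A ⟶ B), E e → Orthogonal e m

/-- The class of morphisms orthogonal on the left to all members of `M`. -/
def upOrth (M : MorphismProperty C) : MorphismProperty C :=
  fun _ _ e => ∀ ⦃X Y : C⦄ (m : X ⟶ Y), M m → Orthogonal e m

/-- A prefactorisation system. -/
structure IsPrefactorisationSystem (E M : MorphismProperty C) : Prop where
  E_eq : E = upOrth M
  M_eq : M = dnOrth E

/-- A factorisation system. -/
structure IsFactorisationSystem (E M : MorphismProperty C) : Prop where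
  E_eq : E = upOrth M
  M_eq : M = dnOrth E
  fac : ∀ ⦃X Y : C⦄ (f : X ⟶ Y),
    ∃ (I : C) (e : X ⟶ I) (m : I ⟶ Y), E e ∧ M m ∧ e ≫ m = f

/-- A pullback-stable class of morphisms. -/
def PullbackStable (E : MorphismProperty C) : Prop :=
  ∀ ⦃P X Y Z : C⦄ (fst : P ⟶ X) (snd : P ⟶ Y) (f : X ⟶ Z) (g : Y ⟶ Z),
    IsPullback fst snd f g → E f → E snd

/-- The class of morphisms inverted by the reflector. -/
def invertedByR (R : Reflection C P) : MorphismProperty C :=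
  fun _ _ f => IsIso (R.F.map f)

/-- The class of morphisms all of whose pullbacks lie in `E` ("stably in `E`"). -/
def StablyIn (E : MorphismProperty C) : MorphismProperty C :=
  fun _ Y e => ∀ ⦃Pb W : C⦄ (fst : Pb ⟶ W) (snd : Pb ⟶ _) (g : W ⟶ Y),
    IsPullback fst snd g e → E fst

/-- The class of morphisms locally in `M`: some pullback along an effective descent
morphism lies in `M`. -/
def locallyIn [HasPullbacks C] (M : MorphismProperty C) : MorphismProperty C :=
  fun _ B f => ∃ (E : C) (p : E ⟶ B), IsEffectiveDescent p ∧
    ∃ (Pb : C) (p1 : Pb ⟶ E) (p2 : Pb ⟶ _), IsPullback p1 p2 p f ∧ M p1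

/-- The class `Ē` associated to a torsion theory: normal epimorphisms with torsion
kernel. -/
def Ebar [HasZeroMorphisms C] (T : C → Prop) : MorphismProperty C :=
  fun X _ e => IsNormalEpiArrow e ∧ ∃ (K : C) (k : K ⟶ X), IsKernelOf k e ∧ T K

/-- The class `M̄` associated to a torsion theory: morphisms with torsion-free
kernel. -/
def Mbar [HasZeroMorphisms C] (F : C → Prop) : MorphismProperty C :=
  fun X _ m => ∃ (K : C) (k : K ⟶ X), IsKernelOf k m ∧ F K

/-- A Birkhoff subcategory: a (regular epi)-reflective subcategory such that the
naturality squares of the unit at regular epimorphisms are pushouts. -/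
structure IsBirkhoff [HasZeroMorphisms C] (R : Reflection C P) : Prop where
  units_regEpi : ∀ X : C, Nonempty (RegularEpi (R.η.app X))
  pushout_units : ∀ ⦃A B : C⦄ (f : A ⟶ B), Nonempty (RegularEpi f) →
    IsPushout f (R.η.app A) (R.η.app B) (R.F.map f)

section ArrowInstances

variable [HasZeroMorphisms C]

instance instZeroArrowHom (f g : Arrow C) : Zero (f ⟶ g) :=
  ⟨{ left := 0, right := 0, w := by simp }⟩

@[simp] lemma arrowHomZero_left (f g : Arrow C) : (0 : f ⟶ g).left = 0 := rfl

@[simp] lemma arrowHomZero_right (f g : Arrow C) : (0 : f ⟶ g).right = 0 := rfl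

instance instArrowHasZeroMorphisms : HasZeroMorphisms (Arrow C) where
  comp_zero {X Y} f Z := by
    apply CommaMorphism.ext <;> simp
  zero_comp X {Y Z} f := by
    apply CommaMorphism.ext <;> simp

end ArrowInstances

/-- `k` is a kernel of `f` in the full subcategory of objects satisfying `P`. -/
def IsKernelOfIn [HasZeroMorphisms C] (P : C → Prop) {K A B : C}
    (k : K ⟶ A) (f : A ⟶ B) : Prop :=
  k ≫ f = 0 ∧ ∀ ⦃W : C⦄, P W → ∀ h : W ⟶ A, h ≫ f = 0 → ∃! l : W ⟶ K, l ≫ k = h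

/-- `m` is a normal monomorphism in the full subcategory of objects satisfying `P`. -/
def IsNormalMonoIn [HasZeroMorphisms C] (P : C → Prop) {K A : C} (m : K ⟶ A) : Prop :=
  ∃ (B : C) (f : A ⟶ B), P B ∧ IsKernelOfIn P m f

/-- `m` is a monomorphism in the full subcategory of objects satisfying `P`. -/
def IsMonoIn (P : C → Prop) {K A : C} (m : K ⟶ A) : Prop :=
  ∀ ⦃W : C⦄, P W → ∀ (a b : W ⟶ K), a ≫ m = b ≫ m → a = b

lemma isKernelOf_iff [HasZeroMorphisms C] {K A B : C} (k : K ⟶ A) (f : A ⟶ B) :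
    IsKernelOf k f ↔
      k ≫ f = 0 ∧ ∀ ⦃W : C⦄ (h : W ⟶ A), h ≫ f = 0 → ∃! l : W ⟶ K, l ≫ k = h := by
  constructor
  · rintro ⟨w, ⟨hl⟩⟩
    refine ⟨w, fun W h hh => ?_⟩
    obtain ⟨l, hl'⟩ := KernelFork.IsLimit.lift' hl h hh
    refine ⟨l, hl', fun l' h' => ?_⟩
    exact Fork.IsLimit.hom_ext hl (h'.trans hl'.symm)
  · rintro ⟨w, H⟩
    refine ⟨w, ⟨KernelFork.IsLimit.ofι k w (fun g hg => (H g hg).choose)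
      (fun g hg => (H g hg).choose_spec.1) (fun g hg m hm => (H g hg).choose_spec.2 m hm)⟩⟩

lemma IsKernelOf.mono [HasZeroMorphisms C] {K A B : C} {k : K ⟶ A} {f : A ⟶ B}
    (h : IsKernelOf k f) : Mono k := by
  rw [isKernelOf_iff] at h
  refine ⟨fun a b hab => ?_⟩
  exact (h.2 (a ≫ k) (by rw [Category.assoc, h.1, comp_zero])).unique rfl hab.symm

lemma IsNormalEpiArrow.regularEpi [HasZeroMorphisms C] {A B : C} {f : A ⟶ B}
    (h : IsNormalEpiArrow f) : Nonempty (RegularEpi f) := by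
  obtain ⟨K, k, w, ⟨hl⟩⟩ := h
  exact ⟨{ W := K, left := k, right := 0, w := by rw [w, zero_comp], isColimit := hl }⟩

lemma regularEpi_epi {A B : C} {f : A ⟶ B} (h : Nonempty (RegularEpi f)) : Epi f := by
  obtain ⟨r⟩ := h
  exact ⟨fun a b hab => Cofork.IsColimit.hom_ext r.isColimit hab⟩

lemma regularEpi_factor_isIso {A B I : C} {f : A ⟶ B} (h : Nonempty (RegularEpi f))
    (q : A ⟶ I) (n : I ⟶ B) [Mono n] (hq : q ≫ n = f) : IsIso n := by
  have := regularEpi_epi h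
  obtain ⟨r⟩ := h
  have hw : r.left ≫ q = r.right ≫ q := by
    rw [← cancel_mono n, Category.assoc, Category.assoc, hq, r.w]
  obtain ⟨d, hd⟩ := Cofork.IsColimit.desc' r.isColimit q hw
  have hd' : f ≫ d = q := hd
  have h1 : d ≫ n = 𝟙 B := by
    rw [← cancel_epi f, ← Category.assoc, hd', hq, Category.comp_id]
  refine ⟨d, ?_, h1⟩
  rw [← cancel_mono n, Category.assoc, h1, Category.comp_id, Category.id_comp]

lemma protoadditive_of_mono [HasZeroObject C] [HasZeroMorphisms C]
    (hC : IsHomological C) (R : Reflection C P) (hne : NormalEpiUnits R)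
    (H : ∀ ⦃K A : C⦄ (k : K ⟶ A), IsProtosplitMono k → IsMonoIn P (R.F.map k)) :
    IsProtoadditive R.F := by
  have := hC.hasFiniteLimits
  intro K A B k f s hs
  obtain ⟨e, hereg, nat, euniv⟩ : ∃ e : ∀ X : C, X ⟶ R.F.obj X,
      (∀ X, Nonempty (RegularEpi (e X))) ∧
      (∀ {X Y : C} (g : X ⟶ Y), g ≫ e Y = e X ≫ R.F.map g) ∧
      (∀ {X B : C}, P B → ∀ f : X ⟶ B, ∃! g : R.F.obj X ⟶ B, e X ≫ g = f) :=
    ⟨fun X => R.η.app X, fun X => (hne X).regularEpi, fun g => R.η.naturality g,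
      fun hB f => R.univ hB f⟩
  have hepi : ∀ X, Epi (e X) := fun X => regularEpi_epi (hereg X)
  have hsplit : R.F.map s ≫ R.F.map f = 𝟙 _ := by
    rw [← R.F.map_comp, hs.split, R.F.map_id]
  refine ⟨?_, hsplit⟩
  have hkmono : Mono k := hs.isKernel.mono
  have hker := (isKernelOf_iff k f).1 hs.isKernel
  have hFk : Mono (R.F.map k) := by
    refine ⟨fun {W} a b hab => ?_⟩
    obtain ⟨a', ha, -⟩ := euniv (R.mem K) a
    obtain ⟨b', hb, -⟩ := euniv (R.mem K) b
    have : a' = b' := H k ⟨B, f, s, hs⟩ (R.mem W) a' b' (by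
      have := hepi W
      rw [← cancel_epi (e W), ← Category.assoc, ← Category.assoc, ha, hb, hab])
    rw [← ha, ← hb, this]
  have hz : R.F.map k ≫ R.F.map f = 0 := by
    have := hepi K
    rw [← cancel_epi (e K), ← R.F.map_comp, ← nat, hker.1, zero_comp, comp_zero]
  let j := kernel.ι (R.F.map f)
  have hj : j ≫ R.F.map f = 0 := kernel.condition _
  let n : R.F.obj K ⟶ kernel (R.F.map f) := kernel.lift _ (R.F.map k) hz
  have hnj : n ≫ j = R.F.map k := kernel.lift_ι _ _ _
  have hn : Mono n := by
    have : Mono (n ≫ j) := by rw [hnj]; exact hFk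
    exact mono_of_mono n j
  have pbM := IsPullback.of_hasPullback (e A) j
  set p1 := pullback.fst (e A) j
  set p2 := pullback.snd (e A) j
  have w : p1 ≫ e A = p2 ≫ j := pbM.w
  have hp2 : Nonempty (RegularEpi p2) :=
    hC.regEpiStable p1 p2 _ _ pbM (hereg A)
  have pbN := IsPullback.of_hasPullback p2 n
  set q1 := pullback.fst p2 n
  set q2 := pullback.snd p2 n
  have hq1 : Mono q1 := inferInstanceAs (Mono (pullback.fst p2 n))
  let t := kernel.ι (e B)
  have ht : t ≫ e B = 0 := kernel.condition _
  have hg0 : (p1 ≫ f) ≫ e B = 0 := by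
    rw [Category.assoc, nat, ← Category.assoc, w, Category.assoc, hj, comp_zero]
  let g := kernel.lift (e B) (p1 ≫ f) hg0
  have hg : g ≫ t = p1 ≫ f := kernel.lift_ι _ _ _
  have hσ0 : (t ≫ s) ≫ e A = (0 : _ ⟶ _) ≫ j := by
    rw [Category.assoc, nat, ← Category.assoc, ht, zero_comp, zero_comp]
  let σ := pbM.lift (t ≫ s) 0 hσ0
  have hσ1 : σ ≫ p1 = t ≫ s := pbM.lift_fst _ _ _
  have hσ2 : σ ≫ p2 = 0 := pbM.lift_snd _ _ _
  have hσg : σ ≫ g = 𝟙 _ := by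
    rw [← cancel_mono t, Category.assoc, hg, ← Category.assoc, hσ1, Category.assoc, hs.split,
      Category.comp_id, Category.id_comp]
  let kM := pbM.lift k (e K ≫ n) (by rw [nat, Category.assoc, hnj])
  have hkM1 : kM ≫ p1 = k := pbM.lift_fst _ _ _
  have hkM2 : kM ≫ p2 = e K ≫ n := pbM.lift_snd _ _ _
  have hkMmono : Mono kM := by
    have : Mono (kM ≫ p1) := by rw [hkM1]; exact hkmono
    exact mono_of_mono kM p1
  have hkMg : kM ≫ g = 0 := by
    rw [← cancel_mono t, Category.assoc, hg, ← Category.assoc, hkM1, hker.1, zero_comp]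
  have hfac : ∀ {W : C} (h : W ⟶ _), h ≫ g = 0 → ∃ l, l ≫ kM = h := by
    intro W h hh
    have h0 : (h ≫ p1) ≫ f = 0 := by
      rw [Category.assoc, ← hg, ← Category.assoc, hh, zero_comp]
    obtain ⟨l, hl, -⟩ := hker.2 (h ≫ p1) h0
    have e1 : (l ≫ kM) ≫ p1 = h ≫ p1 := by rw [Category.assoc, hkM1, hl]
    refine ⟨l, pbM.hom_ext e1 ?_⟩
    rw [← cancel_mono j, Category.assoc, Category.assoc _ p2, ← w, ← Category.assoc, e1,
      Category.assoc]
  have hsM : IsSplitShortExact kM g σ := by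
    refine ⟨(isKernelOf_iff _ _).2 ⟨hkMg, fun W h hh => ?_⟩, hσg⟩
    obtain ⟨l, hl⟩ := hfac h hh
    exact ⟨l, hl, fun l' hl' => by rw [← cancel_mono kM, hl, hl']⟩
  let kN := pbN.lift kM (e K) hkM2
  have hkN1 : kN ≫ q1 = kM := pbN.lift_fst _ _ _
  let σN := pbN.lift σ 0 (by rw [hσ2, zero_comp])
  have hσN1 : σN ≫ q1 = σ := pbN.lift_fst _ _ _
  have hsN : IsSplitShortExact kN (q1 ≫ g) σN := by
    refine ⟨(isKernelOf_iff _ _).2 ⟨?_, fun W h hh => ?_⟩, ?_⟩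
    · rw [← Category.assoc, hkN1, hkMg]
    · obtain ⟨l, hl⟩ := hfac (h ≫ q1) (by rw [Category.assoc, hh])
      refine ⟨l, ?_, fun l' hl' => ?_⟩
      · change l ≫ kN = h
        rw [← cancel_mono q1, Category.assoc, hkN1, hl]
      · rw [← cancel_mono kM, hl, ← hl', Category.assoc, hkN1]
    · rw [← Category.assoc, hσN1, hσg]
  have hiso : IsIso q1 := hC.protomodular kN (q1 ≫ g) σN kM g σ (𝟙 _) q1 (𝟙 _) hsN hsM
    (by rw [hkN1, Category.id_comp]) (by rw [Category.comp_id])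
    (by rw [hσN1, Category.id_comp]) inferInstance inferInstance
  have hniso : IsIso n := regularEpi_factor_isIso hp2 (inv q1 ≫ q2) n (by
    rw [Category.assoc, ← pbN.w, IsIso.inv_hom_id_assoc])
  refine (isKernelOf_iff _ _).2 ⟨hz, fun W h hh => ⟨kernel.lift _ h hh ≫ inv n, ?_, ?_⟩⟩
  · change (kernel.lift _ h hh ≫ inv n) ≫ R.F.map k = h
    rw [← hnj, Category.assoc, IsIso.inv_hom_id_assoc]
    exact kernel.lift_ι _ _ _
  · intro l hl
    rw [← cancel_mono (R.F.map k), hl, ← hnj, Category.assoc, IsIso.inv_hom_id_assoc]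
    exact (kernel.lift_ι _ _ _).symm

/-- Proposition 2.4. Let `C` be a homological category and `R` the
reflector onto a full replete (normal epi)-reflective subcategory `P`. The following
are equivalent: (1) the reflector is protoadditive; (2) it sends protosplit
monomorphisms to normal monomorphisms (of the subcategory); (3) it sends protosplit
monomorphisms to monomorphisms (of the subcategory). -/
theorem statement2 {C : Type u} [Category.{v} C] [HasZeroObject C] [HasZeroMorphisms C]
    (hC : IsHomological C) {P : C → Prop} (hrepl : Replete P)
    (R : Reflection C P) (hne : NormalEpiUnits R) :
    (IsProtoadditive R.F ↔
      ∀ ⦃K A : C⦄ (k : K ⟶ A), IsProtosplitMono k → IsNormalMonoIn P (R.F.map k))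
    ∧ ((∀ ⦃K A : C⦄ (k : K ⟶ A), IsProtosplitMono k → IsNormalMonoIn P (R.F.map k)) ↔
      ∀ ⦃K A : C⦄ (k : K ⟶ A), IsProtosplitMono k → IsMonoIn P (R.F.map k)) := by
  have h12 : IsProtoadditive R.F →
      ∀ ⦃K A : C⦄ (k : K ⟶ A), IsProtosplitMono k → IsNormalMonoIn P (R.F.map k) := by
    rintro h K A k ⟨B, f, s, hs⟩
    have hk := (isKernelOf_iff _ _).1 (h k f s hs).isKernel
    exact ⟨R.F.obj B, R.F.map f, R.mem B, hk.1, fun W _ g hg => hk.2 g hg⟩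
  have h23 : (∀ ⦃K A : C⦄ (k : K ⟶ A), IsProtosplitMono k → IsNormalMonoIn P (R.F.map k)) →
      ∀ ⦃K A : C⦄ (k : K ⟶ A), IsProtosplitMono k → IsMonoIn P (R.F.map k) := by
    intro h K A k hk W hW a b hab
    obtain ⟨B, f, -, w, hf⟩ := h k hk
    exact (hf hW (a ≫ R.F.map k) (by rw [Category.assoc, w, comp_zero])).unique rfl hab.symm
  have h31 := protoadditive_of_mono hC R hne
  exact ⟨⟨h12, fun h => h31 (h23 h)⟩, ⟨h23, fun h => h12 (h31 h)⟩⟩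

end ProtoPaper
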